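/- For d ≥ 3, 1 ≤ r < d/2, |q| < 1, the generating function C_{d,r} satisfies 𝒞_{d,r}(q) = ((-q^r; q^d)_∞ (-q^{d-r}; q^d)_∞ / (q^d; q^d)_∞) · Σ_{n∈ℤ} (-1)^n q^{3dn(n+1)/2} / (1 + q^{r+dn}). -/

import Mathlib

open scoped BigOperators

/-- The infinite q-Pochhammer symbol `(a; q)_∞`. -/
noncomputable def qPochInf (a q : ℂ) : ℂ := ∏' j : ℕ, (1 - a * q ^ j)

/-- A Schur-type partition for parameters `d, r`. -/
def IsSchurPartition (d r : ℕ) (l : List ℕ) : Prop :=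
  (∀ x ∈ l, 0 < x ∧ (x % d = 0 ∨ x % d = r ∨ x % d = d - r)) ∧
    l.Chain' (fun a b => b + d ≤ a ∧ (d ∣ a → b + d < a))

/-- `C_{d,r}(n)`: the number of Schur-type partitions of `n` with smallest part `> d`. -/
noncomputable def schurC (d r n : ℕ) : ℕ :=
  Set.ncard {l : List ℕ | IsSchurPartition d r l ∧ (∀ x ∈ l, d < x) ∧ l.sum = n}

/-- The generating function `𝒞_{d,r}(q) = Σ_{n≥0} C_{d,r}(n) q^n`. -/
noncomputable def schurCGen (d r : ℕ) (q : ℂ) : ℂ := ∑' n : ℕ, (schurC d r n : ℂ) * q ^ n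

open Filter Topology

/-- The finite q-Pochhammer symbol `(a; q)_n`. -/
noncomputable def qPoch (a q : ℂ) (n : ℕ) : ℂ := ∏ j ∈ Finset.range n, (1 - a * q ^ j)

@[simp] lemma qPoch_zero (a q : ℂ) : qPoch a q 0 = 1 := by simp [qPoch]

lemma qPoch_succ (a q : ℂ) (n : ℕ) : qPoch a q (n + 1) = qPoch a q n * (1 - a * q ^ n) := by
  simp [qPoch, Finset.prod_range_succ]

lemma qPoch_self_succ (q : ℂ) (n : ℕ) : qPoch q q (n + 1) = qPoch q q n * (1 - q ^ (n + 1)) := by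
  rw [qPoch_succ, pow_succ']

lemma qPoch_add (a q : ℂ) (m n : ℕ) :
    qPoch a q (m + n) = qPoch a q m * qPoch (a * q ^ m) q n := by
  simp only [qPoch, Finset.prod_range_add]
  congr 1
  exact Finset.prod_congr rfl fun j _ => by ring

lemma qPoch_succ' (a q : ℂ) (n : ℕ) : qPoch a q (n + 1) = (1 - a) * qPoch (a * q) q n := by
  rw [add_comm, qPoch_add]
  simp [qPoch]

lemma qPoch_ne_zero {a q : ℂ} (h : ∀ j, 1 - a * q ^ j ≠ 0) (n : ℕ) : qPoch a q n ≠ 0 :=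
  Finset.prod_ne_zero_iff.mpr fun j _ => h j

lemma one_sub_mul_pow_ne_zero {a q : ℂ} (hq : ‖q‖ < 1) (ha : ‖a‖ < 1) (j : ℕ) :
    1 - a * q ^ j ≠ 0 := by
  intro h
  have h1 : ‖a * q ^ j‖ = 1 := by rw [← sub_eq_zero.mp h, norm_one]
  rw [norm_mul, norm_pow] at h1
  have : ‖q‖ ^ j ≤ 1 := pow_le_one₀ (norm_nonneg _) hq.le
  nlinarith [norm_nonneg a]

lemma one_sub_pow_succ_ne_zero {q : ℂ} (hq : ‖q‖ < 1) (j : ℕ) : 1 - q ^ (j + 1) ≠ 0 := by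
  rw [pow_succ']
  exact one_sub_mul_pow_ne_zero hq hq j

lemma summable_norm_mul_pow {q : ℂ} (hq : ‖q‖ < 1) (a : ℂ) :
    Summable fun j : ℕ => ‖-(a * q ^ j)‖ := by
  simpa only [norm_neg, norm_mul, norm_pow] using
    (summable_geometric_of_lt_one (norm_nonneg q) hq).mul_left ‖a‖

lemma tendsto_qPoch {q : ℂ} (hq : ‖q‖ < 1) (a : ℂ) :
    Tendsto (qPoch a q) atTop (𝓝 (qPochInf a q)) := by
  have h := (multipliable_one_add_of_summable (summable_norm_mul_pow hq a)).tendsto_prod_tprod_nat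
  simp only [← sub_eq_add_neg] at h
  exact h

lemma qPochInf_ne_zero {a q : ℂ} (hq : ‖q‖ < 1) (h : ∀ j, 1 - a * q ^ j ≠ 0) :
    qPochInf a q ≠ 0 := by
  have := tprod_one_add_ne_zero_of_summable (f := fun j : ℕ => -(a * q ^ j))
    (fun j => by simpa only [← sub_eq_add_neg] using h j) (summable_norm_mul_pow hq a)
  simp only [← sub_eq_add_neg] at this
  exact this

lemma qPochInf_eq_mul {q : ℂ} (hq : ‖q‖ < 1) (a : ℂ) (m : ℕ) :
    qPochInf a q = qPoch a q m * qPochInf (a * q ^ m) q := by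
  refine tendsto_nhds_unique ((tendsto_add_atTop_iff_nat m).mpr (tendsto_qPoch hq a)) ?_
  simp only [add_comm _ m, qPoch_add]
  exact (tendsto_qPoch hq _).const_mul _

lemma tendsto_qPochInf_mul_pow {a q : ℂ} (hq : ‖q‖ < 1) (h : ∀ j, 1 - a * q ^ j ≠ 0) :
    Tendsto (fun m : ℕ => qPochInf (a * q ^ m) q) atTop (𝓝 1) := by
  have h1 := (tendsto_const_nhds (x := qPochInf a q)).div (tendsto_qPoch hq a)
    (qPochInf_ne_zero hq h)
  rw [div_self (qPochInf_ne_zero hq h)] at h1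
  refine h1.congr fun m => ?_
  rw [Pi.div_apply, qPochInf_eq_mul hq a m, mul_div_cancel_left₀ _ (qPoch_ne_zero h m)]

lemma exists_norm_qPoch_le {q : ℂ} (hq : ‖q‖ < 1) (a : ℂ) :
    ∃ B : ℝ, 0 < B ∧ ∀ n, ‖qPoch a q n‖ ≤ B := by
  obtain ⟨B, hB, h⟩ := (Metric.isBounded_range_of_tendsto _ (tendsto_qPoch hq a)).exists_pos_norm_le
  exact ⟨B, hB, fun n => h _ ⟨n, rfl⟩⟩

lemma exists_norm_qPoch_inv_le {a q : ℂ} (hq : ‖q‖ < 1) (h : ∀ j, 1 - a * q ^ j ≠ 0) :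
    ∃ B : ℝ, 0 < B ∧ ∀ n, ‖(qPoch a q n)⁻¹‖ ≤ B := by
  obtain ⟨B, hB, h⟩ := (Metric.isBounded_range_of_tendsto _
    ((tendsto_qPoch hq a).inv₀ (qPochInf_ne_zero hq h))).exists_pos_norm_le
  exact ⟨B, hB, fun n => h _ ⟨n, rfl⟩⟩

lemma choose_two_succ (k : ℕ) : (k + 1).choose 2 = k + k.choose 2 := by
  rw [Nat.choose_succ_succ', Nat.choose_one_right]

lemma sum_wellPoised_partial {q : ℂ} (hu : ∀ n, qPoch q q n ≠ 0) (M k : ℕ) (hk : k ≤ M) :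
    (1 - q ^ M) * ∑ i ∈ Finset.range k, (-1) ^ i * q ^ i.choose 2 * (1 - q ^ (2 * i + 1)) /
        (qPoch q q (M - i) * qPoch q q (M + i + 1)) =
      -((1 - q ^ k) * ((-1) ^ k * q ^ k.choose 2) / (qPoch q q (M - k) * qPoch q q (M + k))) := by
  induction k with
  | zero => simp
  | succ k ih =>
    obtain ⟨j, rfl⟩ := Nat.exists_eq_add_of_le hk
    rw [Finset.sum_range_succ, mul_add, ih (by omega), show k + 1 + j - k = j + 1 by omega,
      show k + 1 + j - (k + 1) = j by omega, show k + 1 + j + (k + 1) = k + 1 + j + k + 1 by ring,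
      choose_two_succ]
    have h1 := hu (j + 1)
    have h2 := hu (k + 1 + j + k + 1)
    have h3 := hu j
    have h4 := hu (k + 1 + j + k)
    rw [qPoch_self_succ] at h1 h2
    rw [qPoch_self_succ, qPoch_self_succ q (k + 1 + j + k)]
    have h5 := right_ne_zero_of_mul h1
    have h6 := right_ne_zero_of_mul h2
    field_simp
    ring

lemma sum_wellPoised_eq_zero {q : ℂ} (hq : ‖q‖ < 1) (N : ℕ) :
    ∑ i ∈ Finset.range (N + 2), (-1) ^ i * q ^ i.choose 2 * (1 - q ^ (2 * i + 1)) /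
        (qPoch q q (N + 1 - i) * qPoch q q (N + 1 + i + 1)) = 0 := by
  have hu : ∀ n, qPoch q q n ≠ 0 := qPoch_ne_zero (one_sub_mul_pow_ne_zero hq hq)
  refine (mul_eq_zero.mp ?_).resolve_left (one_sub_pow_succ_ne_zero hq N)
  rw [Finset.sum_range_succ, mul_add, sum_wellPoised_partial hu _ _ le_rfl, Nat.sub_self,
    qPoch_self_succ q (N + 1 + (N + 1)), show 2 * (N + 1) + 1 = N + 1 + (N + 1) + 1 by ring]
  have h1 := one_sub_pow_succ_ne_zero hq (N + 1 + (N + 1))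
  have h2 := hu (N + 1 + (N + 1))
  simp only [qPoch_zero]
  field_simp
  ring

/-- The partial fraction expansion underlying the Bailey pair of the universal mock theta function
`g₃`. -/
lemma sum_div_qPoch_mul_qPoch {q w v : ℂ} (hq : ‖q‖ < 1) (hwv : w * v = q)
    (hw : ∀ j, 1 - w * q ^ j ≠ 0) (hv : ∀ j, 1 - v * q ^ j ≠ 0) (N : ℕ) :
    ∑ k ∈ Finset.range (N + 1), (-1) ^ k * q ^ (k + 1).choose 2 * (1 - q ^ (2 * k + 1)) /
        ((1 - w * q ^ k) * (1 - v * q ^ k)) / (qPoch q q (N - k) * qPoch q q (N + k + 1)) =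
      (qPoch w q (N + 1) * qPoch v q (N + 1))⁻¹ := by
  have hu : ∀ n, qPoch q q n ≠ 0 := qPoch_ne_zero (one_sub_mul_pow_ne_zero hq hq)
  induction N with
  | zero =>
    have h1 := hw 0
    have h2 := hv 0
    have h3 := hu 1
    simp [qPoch] at h1 h2 h3 ⊢
    field_simp
  | succ N ih =>
    rw [qPoch_succ, qPoch_succ v]
    have hE := mul_ne_zero (hw (N + 1)) (hv (N + 1))
    rw [show qPoch w q (N + 1) * (1 - w * q ^ (N + 1)) * (qPoch v q (N + 1) *
      (1 - v * q ^ (N + 1))) = (qPoch w q (N + 1) * qPoch v q (N + 1)) *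
      ((1 - w * q ^ (N + 1)) * (1 - v * q ^ (N + 1))) by ring, mul_inv, ← ih,
      ← div_eq_mul_inv, eq_div_iff hE, mul_comm, Finset.mul_sum, Finset.sum_range_succ,
      ← eq_sub_iff_add_eq', ← Finset.sum_sub_distrib]
    have h := congrArg (q ^ (N + 1) * ·) (sum_wellPoised_eq_zero hq N)
    simp only [mul_zero] at h
    rw [Finset.mul_sum, Finset.sum_range_succ, ← eq_neg_iff_add_eq_zero] at h
    have hlast : (1 - w * q ^ (N + 1)) * (1 - v * q ^ (N + 1)) *
        ((-1) ^ (N + 1) * q ^ (N + 1 + 1).choose 2 * (1 - q ^ (2 * (N + 1) + 1)) /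
        ((1 - w * q ^ (N + 1)) * (1 - v * q ^ (N + 1))) /
          (qPoch q q (N + 1 - (N + 1)) * qPoch q q (N + 1 + (N + 1) + 1))) =
        q ^ (N + 1) * ((-1) ^ (N + 1) * q ^ (N + 1).choose 2 * (1 - q ^ (2 * (N + 1) + 1)) /
          (qPoch q q (N + 1 - (N + 1)) * qPoch q q (N + 1 + (N + 1) + 1))) := by
      rw [← mul_div_assoc, mul_div_cancel₀ _ hE, choose_two_succ (N + 1)]
      ring
    rw [hlast, ← neg_eq_iff_eq_neg.mpr h, ← Finset.sum_neg_distrib]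
    refine Finset.sum_congr rfl fun k hk => ?_
    obtain ⟨j, rfl⟩ := Nat.exists_eq_add_of_le (Nat.lt_succ_iff.mp (Finset.mem_range.mp hk))
    rw [show k + j + 1 - k = j + 1 by omega, show k + j - k = j by omega,
      show k + j + 1 + k + 1 = (k + j + k + 1) + 1 by ring, choose_two_succ k]
    have h1 := hu (j + 1)
    have h2 := hu (k + j + k + 1 + 1)
    have h3 := hu j
    have h4 := hu (k + j + k + 1)
    rw [qPoch_self_succ] at h1 h2
    rw [qPoch_self_succ, qPoch_self_succ q (k + j + k + 1)]
    have h5 := right_ne_zero_of_mul h1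
    have h6 := right_ne_zero_of_mul h2
    have h7 := hw k
    have h8 := hv k
    subst hwv
    field_simp
    ring

/-- The summand of the Durfee rectangle identity. -/
noncomputable def durfeeTerm (q : ℂ) (j m : ℕ) : ℂ :=
  q ^ (m * m + j * m) / (qPoch q q m * qPoch q q (m + j))

lemma exists_norm_durfeeTerm_le {q : ℂ} (hq : ‖q‖ < 1) :
    ∃ B : ℝ, 0 < B ∧ ∀ j m, ‖durfeeTerm q j m‖ ≤ B * ‖q‖ ^ m := by
  obtain ⟨B, hB, h⟩ := exists_norm_qPoch_inv_le hq (one_sub_mul_pow_ne_zero hq hq)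
  refine ⟨B * B, by positivity, fun j m => ?_⟩
  rw [durfeeTerm, div_eq_mul_inv, mul_inv, norm_mul, norm_mul, norm_pow, mul_comm]
  have : ‖q‖ ^ (m * m + j * m) ≤ ‖q‖ ^ m :=
    pow_le_pow_of_le_one (norm_nonneg _) hq.le (by nlinarith [Nat.zero_le (j * m), m.le_mul_self])
  gcongr
  · exact h _
  · exact h _

lemma summable_durfeeTerm {q : ℂ} (hq : ‖q‖ < 1) (j : ℕ) : Summable (durfeeTerm q j) := by
  obtain ⟨B, -, h⟩ := exists_norm_durfeeTerm_le hq
  exact .of_norm_bounded ((summable_geometric_of_lt_one (norm_nonneg q) hq).mul_left B) (h j)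

lemma durfeeTerm_sub {q : ℂ} (hq : ‖q‖ < 1) (j m : ℕ) :
    durfeeTerm q j m - durfeeTerm q (j + 1) m =
      durfeeTerm q j m * (1 - q ^ m) - durfeeTerm q j (m + 1) * (1 - q ^ (m + 1)) := by
  have hu : ∀ n, qPoch q q n ≠ 0 := qPoch_ne_zero (one_sub_mul_pow_ne_zero hq hq)
  have h1 := hu (m + 1)
  have h2 := hu (m + j + 1)
  have h3 := hu m
  have h4 := hu (m + j)
  rw [qPoch_self_succ] at h1 h2
  have h5 := right_ne_zero_of_mul h1
  have h6 := right_ne_zero_of_mul h2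
  simp only [durfeeTerm]
  rw [← add_assoc, show m + 1 + j = m + j + 1 by ring, qPoch_self_succ q m,
    qPoch_self_succ q (m + j)]
  field_simp
  ring

lemma tsum_durfeeTerm_succ {q : ℂ} (hq : ‖q‖ < 1) (j : ℕ) :
    ∑' m, durfeeTerm q (j + 1) m = ∑' m, durfeeTerm q j m := by
  rw [eq_comm, ← sub_eq_zero,
    ← (summable_durfeeTerm hq j).tsum_sub (summable_durfeeTerm hq (j + 1))]
  refine tendsto_nhds_unique
    ((summable_durfeeTerm hq j).sub (summable_durfeeTerm hq (j + 1))).hasSum.tendsto_sum_nat ?_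
  simp only [durfeeTerm_sub hq, Finset.sum_range_sub']
  have h := (summable_durfeeTerm hq j).tendsto_atTop_zero.mul
    ((tendsto_pow_atTop_nhds_zero_of_norm_lt_one hq).const_sub 1)
  simpa using h.neg

/-- The Durfee rectangle identity. -/
lemma tsum_durfeeTerm {q : ℂ} (hq : ‖q‖ < 1) (j : ℕ) :
    ∑' m, durfeeTerm q j m = (qPochInf q q)⁻¹ := by
  have hne := one_sub_mul_pow_ne_zero hq hq
  have hconst : ∀ j, ∑' m, durfeeTerm q j m = ∑' m, durfeeTerm q 0 m := fun j => by
    induction j with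
    | zero => rfl
    | succ j ih => rw [tsum_durfeeTerm_succ hq, ih]
  obtain ⟨B, -, hB⟩ := exists_norm_durfeeTerm_le hq
  have hlim : Tendsto (fun j => ∑' m, durfeeTerm q j m) atTop
      (𝓝 (∑' m : ℕ, if m = 0 then (qPochInf q q)⁻¹ else 0)) := by
    refine tendsto_tsum_of_dominated_convergence
      ((summable_geometric_of_lt_one (norm_nonneg q) hq).mul_left B) (fun m => ?_)
      (Eventually.of_forall hB)
    have hinv := (tendsto_qPoch hq q).inv₀ (qPochInf_ne_zero hq hne)
    rcases Nat.eq_zero_or_pos m with rfl | hm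
    · simpa [durfeeTerm] using hinv
    · rw [if_neg hm.ne']
      have h1 : Tendsto (fun j => (qPoch q q (m + j))⁻¹) atTop (𝓝 (qPochInf q q)⁻¹) := by
        simpa only [add_comm] using (tendsto_add_atTop_iff_nat m).mpr hinv
      have h2 : Tendsto (fun j => (q ^ m) ^ j) atTop (𝓝 0) :=
        tendsto_pow_atTop_nhds_zero_of_norm_lt_one
          (by rw [norm_pow]; exact pow_lt_one₀ (norm_nonneg _) hq hm.ne')
      have h3 := (h2.mul h1).const_mul (q ^ (m * m) * (qPoch q q m)⁻¹)
      rw [zero_mul, mul_zero] at h3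
      refine h3.congr fun j => ?_
      rw [durfeeTerm, pow_add, mul_comm j m, pow_mul q m j, div_eq_mul_inv, mul_inv]
      ring
  rw [tsum_ite_eq] at hlim
  rw [hconst]
  exact tendsto_nhds_unique (tendsto_const_nhds.congr fun j => (hconst j).symm) hlim

lemma exists_norm_one_sub_mul_pow_inv_le {q : ℂ} (hq : ‖q‖ < 1) (a : ℂ) :
    ∃ B : ℝ, 0 < B ∧ ∀ j, ‖(1 - a * q ^ j)⁻¹‖ ≤ B := by
  have hlim : Tendsto (fun j : ℕ => (1 - a * q ^ j)⁻¹) atTop (𝓝 1⁻¹) := by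
    refine Tendsto.inv₀ ?_ one_ne_zero
    simpa using ((tendsto_pow_atTop_nhds_zero_of_norm_lt_one hq).const_mul a).const_sub 1
  obtain ⟨B, hB, h⟩ := (Metric.isBounded_range_of_tendsto _ hlim).exists_pos_norm_le
  exact ⟨B, hB, fun n => h _ ⟨n, rfl⟩⟩

/-- The universal mock theta function `g₃` as an Appell–Lerch series over the natural numbers. -/
lemma tsum_mockTheta_eq {q w v : ℂ} (hq : ‖q‖ < 1) (hwv : w * v = q)
    (hw : ∀ j, 1 - w * q ^ j ≠ 0) (hv : ∀ j, 1 - v * q ^ j ≠ 0) :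
    ∑' n : ℕ, q ^ (n * (n + 1)) / (qPoch w q (n + 1) * qPoch v q (n + 1)) =
      (qPochInf q q)⁻¹ * ∑' k : ℕ, (-1) ^ k * q ^ ((k + 1).choose 2 + k * (k + 1)) *
        (1 - q ^ (2 * k + 1)) / ((1 - w * q ^ k) * (1 - v * q ^ k)) := by
  set τ : ℕ → ℂ := fun k => (-1) ^ k * q ^ ((k + 1).choose 2 + k * (k + 1)) *
    (1 - q ^ (2 * k + 1)) / ((1 - w * q ^ k) * (1 - v * q ^ k)) with hτ
  set F : ℕ × ℕ → ℂ := fun p => τ p.1 * durfeeTerm q (2 * p.1 + 1) p.2 with hF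
  have hFsum : Summable F := by
    obtain ⟨A, hA, hA'⟩ := exists_norm_durfeeTerm_le hq
    obtain ⟨B, hB, hB'⟩ := exists_norm_one_sub_mul_pow_inv_le hq w
    obtain ⟨C, hC, hC'⟩ := exists_norm_one_sub_mul_pow_inv_le hq v
    have hg := summable_geometric_of_lt_one (norm_nonneg q) hq
    refine .of_norm_bounded ((hg.mul_of_nonneg hg (fun _ => by positivity)
      (fun _ => by positivity)).mul_left (2 * B * C * A)) fun p => ?_
    have h1 : ‖τ p.1‖ ≤ ‖q‖ ^ p.1 * 2 * (B * C) := by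
      rw [hτ]
      simp only [div_eq_mul_inv, mul_inv, norm_mul, norm_pow, norm_neg, norm_one, one_pow, one_mul]
      have h2 : ‖q‖ ^ ((p.1 + 1).choose 2 + p.1 * (p.1 + 1)) ≤ ‖q‖ ^ p.1 :=
        pow_le_pow_of_le_one (norm_nonneg _) hq.le (by nlinarith [Nat.zero_le ((p.1 + 1).choose 2)])
      have h3 : ‖1 - q ^ (2 * p.1 + 1)‖ ≤ 2 := by
        refine (norm_sub_le _ _).trans ?_
        rw [norm_one, norm_pow]
        linarith [pow_le_one₀ (norm_nonneg q) hq.le (n := 2 * p.1 + 1)]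
      gcongr
      · exact hB' _
      · exact hC' _
    calc ‖F p‖ ≤ (‖q‖ ^ p.1 * 2 * (B * C)) * (A * ‖q‖ ^ p.2) := by
          rw [hF, norm_mul]
          gcongr
          exact hA' _ _
      _ = _ := by ring
  have hprod : ∑' p, F p = (qPochInf q q)⁻¹ * ∑' k, τ k := by
    rw [hFsum.tsum_prod]
    simp only [hF, tsum_mul_left, tsum_durfeeTerm hq, tsum_mul_right]
    rw [mul_comm]
  rw [← hprod, ← Finset.HasAntidiagonal.sigmaAntidiagonalEquivProd.tsum_eq F,
    Summable.tsum_sigma (f := fun c => F (Finset.HasAntidiagonal.sigmaAntidiagonalEquivProd c))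
      (Finset.HasAntidiagonal.sigmaAntidiagonalEquivProd.summable_iff.mpr hFsum)]
  refine tsum_congr fun n => ?_
  rw [div_eq_mul_inv, ← sum_div_qPoch_mul_qPoch hq hwv hw hv, Finset.mul_sum, tsum_fintype,
    ← Finset.Nat.sum_antidiagonal_eq_sum_range_succ (fun k m => q ^ (n * (n + 1)) *
      ((-1) ^ k * q ^ (k + 1).choose 2 * (1 - q ^ (2 * k + 1)) /
        ((1 - w * q ^ k) * (1 - v * q ^ k)) / (qPoch q q m * qPoch q q (n + k + 1)))),
    ← Finset.sum_coe_sort (Finset.HasAntidiagonal.antidiagonal n)]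
  refine Finset.sum_congr rfl fun p _ => ?_
  obtain ⟨⟨k, m⟩, hp⟩ := p
  rw [Finset.HasAntidiagonal.mem_antidiagonal] at hp
  subst hp
  simp only [hF, hτ, durfeeTerm, Finset.HasAntidiagonal.sigmaAntidiagonalEquivProd_apply]
  rw [show m + (2 * k + 1) = k + m + k + 1 by ring, show (k + m) * (k + m + 1) =
    k * (k + 1) + (m * m + (2 * k + 1) * m) by ring]
  simp only [pow_add, div_eq_mul_inv, mul_inv]
  ring

lemma one_sub_mul_qPoch_mul (a q : ℂ) (n : ℕ) :
    (1 - a) * qPoch (a * q) q n = qPoch a q n * (1 - a * q ^ n) := by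
  rw [← qPoch_succ', qPoch_succ]

lemma norm_mul_pow_lt_one {a q : ℂ} (hq : ‖q‖ < 1) (ha : ‖a‖ < 1) (k : ℕ) : ‖a * q ^ k‖ < 1 := by
  rw [norm_mul, norm_pow]
  exact (mul_le_of_le_one_right (norm_nonneg _) (pow_le_one₀ (norm_nonneg _) hq.le)).trans_lt ha

lemma exists_norm_qPoch_shift_le {a q : ℂ} (hq : ‖q‖ < 1) (ha : ‖a‖ < 1) :
    ∃ B : ℝ, 0 < B ∧ ∀ k n, ‖qPoch (a * q ^ k) q n‖ ≤ B ∧ ‖(qPoch (a * q ^ k) q n)⁻¹‖ ≤ B := by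
  have hne := one_sub_mul_pow_ne_zero hq ha
  obtain ⟨B, hB, h⟩ := exists_norm_qPoch_le hq a
  obtain ⟨C, hC, h'⟩ := exists_norm_qPoch_inv_le hq hne
  have key : ∀ k n, qPoch (a * q ^ k) q n = (qPoch a q k)⁻¹ * qPoch a q (k + n) := fun k n => by
    rw [qPoch_add, inv_mul_cancel_left₀ (qPoch_ne_zero hne k)]
  refine ⟨C * B, by positivity, fun k n => ⟨?_, ?_⟩⟩
  · rw [key, norm_mul]
    gcongr
    · exact h' _
    · exact h _
  · rw [key, mul_inv, inv_inv, norm_mul, mul_comm]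
    gcongr
    · exact h' _
    · exact h _

/-- The summand of the basic hypergeometric solution of the Schur `q`-difference equation. -/
noncomputable def schurTerm (q w v x : ℂ) (n : ℕ) : ℂ :=
  qPoch x q n * x ^ n * q ^ (n * n) / (qPoch q q n * qPoch (w * x) q n * qPoch (v * x) q n)

lemma exists_norm_schurTerm_le {q w v : ℂ} (hq : ‖q‖ < 1) (hw : ‖w‖ < 1) (hv : ‖v‖ < 1) :
    ∃ B : ℝ, 0 < B ∧ ∀ k n, ‖schurTerm q w v (q * q ^ k) n‖ ≤ B * (‖q‖ ^ k) ^ n * ‖q‖ ^ n := by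
  obtain ⟨B, hB, h⟩ := exists_norm_qPoch_shift_le hq hq
  obtain ⟨C, hC, h'⟩ := exists_norm_qPoch_inv_le hq (one_sub_mul_pow_ne_zero hq hq)
  obtain ⟨Bw, hBw, hw'⟩ := exists_norm_qPoch_shift_le hq hw
  obtain ⟨Bv, hBv, hv'⟩ := exists_norm_qPoch_shift_le hq hv
  refine ⟨B * (C * Bw * Bv), by positivity, fun k n => ?_⟩
  have h1 : ‖q‖ ^ (n * n) ≤ 1 := pow_le_one₀ (norm_nonneg _) hq.le
  have h2 : ∀ c : ℂ, c * (q * q ^ k) = c * q ^ (k + 1) := fun c => by ring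
  have h3 := (h k n).1
  have h4 := h' n
  have h5 := (hw' (k + 1) n).2
  have h6 := (hv' (k + 1) n).2
  rw [schurTerm, div_eq_mul_inv, mul_inv, mul_inv, h2 w, h2 v]
  simp only [norm_mul, norm_pow, mul_pow]
  calc _ ≤ B * (‖q‖ ^ n * (‖q‖ ^ k) ^ n) * 1 * (C * Bw * Bv) := by gcongr
    _ = _ := by ring

lemma summable_schurTerm {q w v : ℂ} (hq : ‖q‖ < 1) (hw : ‖w‖ < 1) (hv : ‖v‖ < 1) (k : ℕ) :
    Summable (schurTerm q w v (q * q ^ k)) := by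
  obtain ⟨B, hB, h⟩ := exists_norm_schurTerm_le hq hw hv
  refine .of_norm_bounded ((summable_geometric_of_lt_one (norm_nonneg q) hq).mul_left B)
    fun n => (h k n).trans ?_
  gcongr
  exact mul_le_of_le_one_right hB.le
    (pow_le_one₀ (by positivity) (pow_le_one₀ (norm_nonneg _) hq.le))

/-- The telescoping certificate for `schurTerm`. -/
noncomputable def schurCert (q w v x : ℂ) (n : ℕ) : ℂ :=
  schurTerm q w v x n * ((1 - q ^ n) *
    (x - (1 - x * q ^ n) / ((1 - w * x * q ^ n) * (1 - v * x * q ^ n))) / (1 - x))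

lemma schurCert_identity {w v x N : ℂ} (x1 : 1 - x ≠ 0) (w3 : 1 - w * x * N ≠ 0)
    (v3 : 1 - v * x * N ≠ 0) :
    1 - (1 - (w + v) * x) * ((1 - x * N) * N /
        ((1 - x) * ((1 - w * x * N) * (1 - v * x * N))))
      - x * (w * v) * (N ^ 2 * (1 - x * N) * (1 - x * (N * (w * v))) /
        ((1 - x) * ((1 - w * x * N) * (1 - v * x * N) *
          ((1 - w * x * (N * (w * v))) * (1 - v * x * (N * (w * v))))))) =
      (1 - x * N) * x * N ^ 2 * (w * v) / ((1 - w * x * N) * (1 - v * x * N)) *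
        ((x - (1 - x * (N * (w * v))) /
          ((1 - w * x * (N * (w * v))) * (1 - v * x * (N * (w * v))))) / (1 - x))
      - (1 - N) * (x - (1 - x * N) / ((1 - w * x * N) * (1 - v * x * N))) / (1 - x) := by
  field_simp
  ring

lemma schurTerm_telescope {q w v x : ℂ} (hq : ‖q‖ < 1) (hw : ‖w‖ < 1) (hv : ‖v‖ < 1)
    (hwv : w * v = q) (hx : ‖x‖ < 1) (n : ℕ) :
    schurTerm q w v x n
      - (1 - (w + v) * x) / ((1 - w * x) * (1 - v * x)) * schurTerm q w v (x * q) n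
      - x * q * (1 - x * q) / ((1 - w * x) * (1 - v * x) * ((1 - w * x * q) * (1 - v * x * q))) *
        schurTerm q w v (x * q * q) n =
      schurCert q w v x (n + 1) - schurCert q w v x n := by
  have hwx : ‖w * x‖ < 1 := by
    rw [norm_mul]; exact mul_lt_one_of_nonneg_of_lt_one_left (norm_nonneg _) hw hx.le
  have hvx : ‖v * x‖ < 1 := by
    rw [norm_mul]; exact mul_lt_one_of_nonneg_of_lt_one_left (norm_nonneg _) hv hx.le
  have shift : ∀ {a : ℂ}, ‖a‖ < 1 →
      qPoch (a * q) q n = qPoch a q n * (1 - a * q ^ n) / (1 - a) := fun {a} ha => by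
    have : 1 - a ≠ 0 := by simpa using one_sub_mul_pow_ne_zero hq ha 0
    rw [eq_div_iff this, mul_comm, one_sub_mul_qPoch_mul]
  have hmul : ∀ {a : ℂ}, ‖a‖ < 1 → ‖a * q‖ < 1 := fun {a} ha => by
    simpa using norm_mul_pow_lt_one hq ha 1
  have shift2 : ∀ {a : ℂ}, ‖a‖ < 1 → qPoch (a * q * q) q n =
      qPoch a q n * (1 - a * q ^ n) * (1 - a * q ^ (n + 1)) / ((1 - a) * (1 - a * q)) :=
    fun {a} ha => by
      rw [shift (hmul ha), shift ha, pow_succ', div_mul_eq_mul_div, div_div, mul_assoc a q]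
  have n0 : ∀ {a : ℂ}, ‖a‖ < 1 → 1 - a ≠ 0 := fun {a} ha => by
    simpa using one_sub_mul_pow_ne_zero hq ha 0
  have x1 := n0 hx
  have x2 := n0 (hmul hx)
  have w1 := n0 hwx
  have w2 := n0 (hmul hwx)
  have w3 := one_sub_mul_pow_ne_zero hq hwx n
  have v1 := n0 hvx
  have v2 := n0 (hmul hvx)
  have v3 := one_sub_mul_pow_ne_zero hq hvx n
  have q1 := one_sub_pow_succ_ne_zero hq n
  have e1 : schurTerm q w v (x * q) n = schurTerm q w v x n * ((1 - w * x) * (1 - v * x)) *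
      ((1 - x * q ^ n) * q ^ n /
        ((1 - x) * ((1 - w * x * q ^ n) * (1 - v * x * q ^ n)))) := by
    simp only [schurTerm, ← mul_assoc, shift hx, shift hwx, shift hvx, mul_pow, div_eq_mul_inv,
      mul_inv, inv_inv]
    generalize 1 - w * x * q ^ n = w3, 1 - v * x * q ^ n = v3, 1 - x * q ^ n = x3,
      1 - w * x = w1, 1 - v * x = v1, 1 - x = x1
    ring
  have e2 : schurTerm q w v (x * q * q) n = schurTerm q w v x n *
      ((1 - w * x) * (1 - v * x) * ((1 - w * x * q) * (1 - v * x * q))) *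
      ((q ^ n) ^ 2 * (1 - x * q ^ n) * (1 - x * (q ^ n * q)) /
        ((1 - x) * ((1 - w * x * q ^ n) * (1 - v * x * q ^ n) *
          ((1 - w * x * (q ^ n * q)) * (1 - v * x * (q ^ n * q)))))) / (1 - x * q) := by
    simp only [schurTerm, ← mul_assoc w, ← mul_assoc v, shift2 hx, shift2 hwx, shift2 hvx, mul_pow]
    simp only [pow_succ q n, div_eq_mul_inv, mul_inv, inv_inv]
    generalize 1 - w * x * (q ^ n * q) = w4, 1 - v * x * (q ^ n * q) = v4,
      1 - x * (q ^ n * q) = x4, 1 - w * x * q ^ n = w3, 1 - v * x * q ^ n = v3,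
      1 - x * q ^ n = x3, 1 - w * x * q = w2, 1 - v * x * q = v2, 1 - w * x = w1, 1 - v * x = v1,
      1 - x * q = x2, 1 - x = x1
    ring
  have e3 : schurTerm q w v x (n + 1) = schurTerm q w v x n *
      ((1 - x * q ^ n) * x * (q ^ n) ^ 2 * q /
        ((1 - w * x * q ^ n) * (1 - v * x * q ^ n))) / (1 - q ^ n * q) := by
    simp only [schurTerm, qPoch_self_succ q n, qPoch_succ _ q n, pow_succ q n,
      show (n + 1) * (n + 1) = n * n + n + n + 1 by ring, pow_add, pow_one,
      div_eq_mul_inv, mul_inv, ← mul_assoc]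
    generalize 1 - w * x * q ^ n = w3, 1 - v * x * q ^ n = v3, 1 - x * q ^ n = x3,
      1 - q ^ n * q = q3
    ring
  have cancel₁ : ∀ {T a A r : ℂ}, A ≠ 0 → a / A * (T * A * r) = T * (a * r) :=
    fun hA => by field_simp
  have cancel₂ : ∀ {T a s A r : ℂ}, A ≠ 0 → s ≠ 0 →
      a * s / A * (T * A * r / s) = T * (a * r) := fun hA hs => by field_simp
  have cancel₃ : ∀ {T r s p y : ℂ}, s ≠ 0 → T * r / s * (s * p / y) = T * (r * (p / y)) :=
    fun hs => by field_simp
  rw [pow_succ] at q1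
  rw [schurCert, schurCert, e1, e2, e3, cancel₁ (mul_ne_zero w1 v1),
    cancel₂ (mul_ne_zero (mul_ne_zero w1 v1) (mul_ne_zero w2 v2)) x2, pow_succ q n, cancel₃ q1]
  subst hwv
  linear_combination schurTerm (w * v) w v x n * schurCert_identity x1 w3 v3

lemma tendsto_schurCert {q w v : ℂ} (hq : ‖q‖ < 1) (hw : ‖w‖ < 1) (hv : ‖v‖ < 1) (k : ℕ) :
    Tendsto (schurCert q w v (q * q ^ k)) atTop (𝓝 0) := by
  have hp := tendsto_pow_atTop_nhds_zero_of_norm_lt_one hq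
  have h1 : ∀ a : ℂ, Tendsto (fun n : ℕ => 1 - a * q ^ n) atTop (𝓝 1) := fun a => by
    simpa using (hp.const_mul a).const_sub 1
  have h2 := (((h1 1).mul (((h1 (q * q ^ k)).div
    ((h1 (w * (q * q ^ k))).mul (h1 (v * (q * q ^ k)))) (by simp)).const_sub
      (q * q ^ k))).div_const (1 - q * q ^ k))
  have h3 := (summable_schurTerm hq hw hv k).tendsto_atTop_zero.mul h2
  rw [zero_mul] at h3
  refine h3.congr fun n => ?_
  simp [schurCert]

/-- The basic hypergeometric solution of the Schur `q`-difference equation. -/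
noncomputable def schurSol (q w v : ℂ) (k : ℕ) : ℂ :=
  qPochInf (w * q ^ (k + 1)) q * qPochInf (v * q ^ (k + 1)) q *
    ∑' n, schurTerm q w v (q * q ^ k) n

lemma schurSol_rec {q w v : ℂ} (hq : ‖q‖ < 1) (hw : ‖w‖ < 1) (hv : ‖v‖ < 1)
    (hwv : w * v = q) (k : ℕ) :
    schurSol q w v k = (1 - (w + v) * q ^ (k + 1)) * schurSol q w v (k + 1) +
      q ^ (k + 2) * (1 - q ^ (k + 2)) * schurSol q w v (k + 2) := by
  have hx : ‖q * q ^ k‖ < 1 := norm_mul_pow_lt_one hq hq k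
  have hs := summable_schurTerm hq hw hv
  have e1 : q * q ^ k * q = q * q ^ (k + 1) := by ring
  have e2 : q * q ^ (k + 1) * q = q * q ^ (k + 2) := by ring
  have key : (∑' n, schurTerm q w v (q * q ^ k) n)
      - (1 - (w + v) * (q * q ^ k)) / ((1 - w * (q * q ^ k)) * (1 - v * (q * q ^ k))) *
        (∑' n, schurTerm q w v (q * q ^ (k + 1)) n)
      - q * q ^ k * q * (1 - q * q ^ k * q) / ((1 - w * (q * q ^ k)) * (1 - v * (q * q ^ k)) *
          ((1 - w * (q * q ^ k) * q) * (1 - v * (q * q ^ k) * q))) *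
        (∑' n, schurTerm q w v (q * q ^ (k + 2)) n) = 0 := by
    refine tendsto_nhds_unique (((hs k).hasSum.sub ((hs (k + 1)).hasSum.mul_left _)).sub
      ((hs (k + 2)).hasSum.mul_left _)).tendsto_sum_nat ?_
    rw [← e2, ← e1]
    simp only [schurTerm_telescope hq hw hv hwv hx, Finset.sum_range_sub]
    simpa [schurCert] using (tendsto_schurCert hq hw hv k).sub_const (schurCert q w v (q * q ^ k) 0)
  have step : ∀ (a : ℂ) (m : ℕ),
      qPochInf (a * q ^ m) q = (1 - a * q ^ m) * qPochInf (a * q ^ (m + 1)) q := fun a m => by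
    rw [qPochInf_eq_mul hq (a * q ^ m) 1, qPoch_succ, qPoch_zero]
    simp [pow_succ, mul_assoc]
  have hw1 := one_sub_mul_pow_ne_zero hq hw (k + 1)
  have hw2 := one_sub_mul_pow_ne_zero hq hw (k + 2)
  have hv1 := one_sub_mul_pow_ne_zero hq hv (k + 1)
  have hv2 := one_sub_mul_pow_ne_zero hq hv (k + 2)
  simp only [show q * q ^ k * q = q ^ (k + 2) by ring, show ∀ a, a * (q * q ^ k) = a * q ^ (k + 1)
    from fun a => by ring, show ∀ a, a * q ^ (k + 1) * q = a * q ^ (k + 2)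
    from fun a => by ring] at key
  simp only [schurSol]
  rw [step w (k + 1), step v (k + 1), step w (k + 1 + 1), step v (k + 1 + 1)]
  rw [sub_sub, sub_eq_zero] at key
  rw [key]
  simp only [add_assoc, Nat.reduceAdd]
  generalize 1 - w * q ^ (k + 1) = w1, 1 - w * q ^ (k + 2) = w2, 1 - v * q ^ (k + 1) = v1,
    1 - v * q ^ (k + 2) = v2, 1 - (w + v) * q ^ (k + 1) = c, 1 - q ^ (k + 2) = c' at *
  field_simp

lemma tendsto_schurSol {q w v : ℂ} (hq : ‖q‖ < 1) (hw : ‖w‖ < 1) (hv : ‖v‖ < 1) :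
    Tendsto (schurSol q w v) atTop (𝓝 1) := by
  have hlim : ∀ {a : ℂ}, ‖a‖ < 1 →
      Tendsto (fun k : ℕ => qPochInf (a * q ^ (k + 1)) q) atTop (𝓝 1) := fun ha =>
    (tendsto_add_atTop_iff_nat 1).mpr
      (tendsto_qPochInf_mul_pow hq (one_sub_mul_pow_ne_zero hq ha))
  obtain ⟨B, hB, h⟩ := exists_norm_schurTerm_le hq hw hv
  have hsum : Tendsto (fun k => ∑' n, schurTerm q w v (q * q ^ k) n) atTop
      (𝓝 (∑' n : ℕ, if n = 0 then 1 else 0)) := by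
    refine tendsto_tsum_of_dominated_convergence
      ((summable_geometric_of_lt_one (norm_nonneg q) hq).mul_left B) (fun n => ?_)
      (Eventually.of_forall fun k n => (h k n).trans ?_)
    · rcases Nat.eq_zero_or_pos n with rfl | hn
      · simp [schurTerm]
      · rw [if_neg hn.ne']
        refine squeeze_zero_norm (fun k => h k n) ?_
        have h1 := (tendsto_pow_atTop_nhds_zero_of_lt_one (norm_nonneg q) hq).pow n
        rw [zero_pow hn.ne'] at h1
        simpa using (h1.const_mul B).mul_const (‖q‖ ^ n)
    · gcongr
      exact mul_le_of_le_one_right hB.le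
        (pow_le_one₀ (by positivity) (pow_le_one₀ (norm_nonneg _) hq.le))
  rw [tsum_ite_eq] at hsum
  have h1 := ((hlim hw).mul (hlim hv)).mul hsum
  rwa [mul_one, mul_one] at h1

lemma eq_zero_of_norm_le_max {H : ℕ → ℂ} {ε : ℕ → ℝ} (hε : ∀ k, 0 ≤ ε k) (hs : Summable ε)
    (hH : ∀ k, ‖H k‖ ≤ (1 + ε k) * max ‖H (k + 1)‖ ‖H (k + 2)‖)
    (h0 : Tendsto H atTop (𝓝 0)) (k : ℕ) : H k = 0 := by
  set M : ℕ → ℝ := fun k => max ‖H k‖ ‖H (k + 1)‖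
  set P : ℕ → ℝ := fun k => ∏ j ∈ Finset.range k, (1 + ε j)
  have hP : ∀ k, 0 < P k := fun k => Finset.prod_pos fun j _ => by linarith [hε j]
  have hM : ∀ k, M k ≤ (1 + ε k) * M (k + 1) := fun k => by
    refine max_le (hH k) ((le_max_left ‖H (k + 1)‖ ‖H (k + 2)‖).trans ?_)
    exact le_mul_of_one_le_left (le_max_of_le_left (norm_nonneg _)) (by linarith [hε k])
  have hmono : Monotone fun k => P k * M k := monotone_nat_of_le_succ fun k => by
    simp only [P, Finset.prod_range_succ]
    rw [mul_assoc]
    exact mul_le_mul_of_nonneg_left (hM k) (hP k).le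
  have hMlim : Tendsto M atTop (𝓝 0) := by
    have h1 := h0.norm
    have h2 := h1.max ((tendsto_add_atTop_iff_nat 1).mpr h1)
    simpa using h2
  have hPlim := (multipliable_one_add_of_summable (f := ε)
    (by simpa [abs_of_nonneg (hε _)] using hs)).tendsto_prod_tprod_nat
  have hlim := hPlim.mul hMlim
  rw [mul_zero] at hlim
  have h3 := hmono.ge_of_tendsto hlim k
  have h4 : M k ≤ 0 := nonpos_of_mul_nonpos_right h3 (hP k)
  exact norm_le_zero_iff.mp ((le_max_left _ _).trans h4)

/-- Uniqueness of the solution with limit `1` of the Schur `q`-difference equation. -/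
lemma eq_schurSol {q w v : ℂ} (hq : ‖q‖ < 1) (hw : ‖w‖ < 1) (hv : ‖v‖ < 1) (hwv : w * v = q)
    {G : ℕ → ℂ} (hG : ∀ k, G k = (1 - (w + v) * q ^ (k + 1)) * G (k + 1) +
      q ^ (k + 2) * (1 - q ^ (k + 2)) * G (k + 2)) (hlim : Tendsto G atTop (𝓝 1)) (k : ℕ) :
    G k = schurSol q w v k := by
  rw [← sub_eq_zero]
  refine eq_zero_of_norm_le_max (H := fun k => G k - schurSol q w v k)
    (ε := fun k => 4 * ‖q‖ ^ k) (fun k => by positivity)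
    ((summable_geometric_of_lt_one (norm_nonneg q) hq).mul_left 4) (fun k => ?_)
    (by simpa using hlim.sub (tendsto_schurSol hq hw hv)) k
  have e : G k - schurSol q w v k =
      (1 - (w + v) * q ^ (k + 1)) * (G (k + 1) - schurSol q w v (k + 1)) +
      q ^ (k + 2) * (1 - q ^ (k + 2)) * (G (k + 2) - schurSol q w v (k + 2)) := by
    rw [hG k, schurSol_rec hq hw hv hwv k]
    ring
  have hp : ∀ m, ‖q‖ ^ (k + m) ≤ ‖q‖ ^ k := fun m =>
    pow_le_pow_of_le_one (norm_nonneg _) hq.le (Nat.le_add_right _ _)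
  have h1 : ‖1 - (w + v) * q ^ (k + 1)‖ ≤ 1 + 2 * ‖q‖ ^ k := by
    refine (norm_sub_le _ _).trans ?_
    rw [norm_one, norm_mul, norm_pow]
    exact add_le_add_right (mul_le_mul (by linarith [norm_add_le w v]) (hp 1) (by positivity)
      (by norm_num)) _
  have h2 : ‖q ^ (k + 2) * (1 - q ^ (k + 2))‖ ≤ ‖q‖ ^ k * 2 := by
    rw [norm_mul, norm_pow]
    refine mul_le_mul (hp 2) ((norm_sub_le _ _).trans ?_) (norm_nonneg _) (by positivity)
    rw [norm_one, norm_pow]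
    linarith [pow_le_one₀ (norm_nonneg q) hq.le (n := k + 2)]
  rw [e]
  refine (norm_add_le _ _).trans ?_
  rw [norm_mul, norm_mul]
  set m := max ‖G (k + 1) - schurSol q w v (k + 1)‖ ‖G (k + 2) - schurSol q w v (k + 2)‖
  calc _ ≤ (1 + 2 * ‖q‖ ^ k) * m + ‖q‖ ^ k * 2 * m := by
        gcongr
        · exact le_max_left _ _
        · exact le_max_right _ _
    _ = _ := by ring

lemma schurSol_zero {q w v : ℂ} (hq : ‖q‖ < 1) (hw : ‖w‖ < 1) (hv : ‖v‖ < 1) :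
    schurSol q w v 0 = qPochInf w q * qPochInf v q *
      ∑' n : ℕ, q ^ (n * (n + 1)) / (qPoch w q (n + 1) * qPoch v q (n + 1)) := by
  have hs : ∀ n, schurTerm q w v (q * q ^ 0) n = (1 - w) * (1 - v) *
      (q ^ (n * (n + 1)) / (qPoch w q (n + 1) * qPoch v q (n + 1))) := fun n => by
    have h1 := qPoch_ne_zero (one_sub_mul_pow_ne_zero hq hq) n
    have h2 : 1 - w ≠ 0 := by simpa using one_sub_mul_pow_ne_zero hq hw 0
    have h3 : 1 - v ≠ 0 := by simpa using one_sub_mul_pow_ne_zero hq hv 0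
    rw [qPoch_succ', qPoch_succ', schurTerm, pow_zero, mul_one,
      show n * (n + 1) = n + n * n by ring, pow_add]
    field_simp
  rw [schurSol, tsum_congr hs, tsum_mul_left, qPochInf_eq_mul hq w 1, qPochInf_eq_mul hq v 1,
    qPoch_succ, qPoch_succ]
  simp only [qPoch_zero, pow_zero, mul_one, one_mul, zero_add]
  ring

lemma summable_sign_mul_pow_div {q : ℂ} (hq : ‖q‖ < 1) (w : ℂ) :
    Summable fun k : ℕ => (-1) ^ k * q ^ ((k + 1).choose 2 + k * (k + 1)) / (1 - w * q ^ k) := by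
  obtain ⟨B, hB, h⟩ := exists_norm_one_sub_mul_pow_inv_le hq w
  refine .of_norm_bounded ((summable_geometric_of_lt_one (norm_nonneg q) hq).mul_right B)
    fun k => ?_
  rw [div_eq_mul_inv, norm_mul, norm_mul, norm_pow, norm_neg, norm_one, one_pow, one_mul, norm_pow]
  refine mul_le_mul (pow_le_pow_of_le_one (norm_nonneg q) hq.le ?_) (h k) (norm_nonneg _)
    (by positivity)
  nlinarith

lemma mul_mul_succ_ediv_two (d : ℤ) (k : ℕ) :
    3 * d * k * (k + 1) / 2 = d * ((k + 1).choose 2 + k * (k + 1) : ℕ) := by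
  refine Int.ediv_eq_of_eq_mul_right two_ne_zero ?_
  have h : ((k + 1).choose 2 * 2 : ℤ) = k * (k + 1) := by
    rw [Nat.choose_two_right, Nat.add_sub_cancel]
    rw_mod_cast [Nat.div_mul_cancel (mul_comm k (k + 1) ▸ Nat.two_dvd_mul_add_one k), mul_comm]
  push_cast
  linear_combination -d * h

lemma tsum_int_eq_tsum_nat {d r : ℕ} (hr1 : 1 ≤ r) (hr2 : r < d) {q : ℂ} (hq : ‖q‖ < 1)
    (hq0 : q ≠ 0) :
    ∑' n : ℤ, (-1) ^ n * q ^ (3 * d * n * (n + 1) / 2) / (1 + q ^ ((r : ℤ) + d * n)) =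
      ∑' k : ℕ, (-1) ^ k * (q ^ d) ^ ((k + 1).choose 2 + k * (k + 1)) *
        (1 - (q ^ d) ^ (2 * k + 1)) /
          ((1 - -q ^ r * (q ^ d) ^ k) * (1 - -q ^ (d - r) * (q ^ d) ^ k)) := by
  have hlt : ∀ {m : ℕ}, 0 < m → ‖q ^ m‖ < 1 := fun hm => by
    rw [norm_pow]; exact pow_lt_one₀ (norm_nonneg q) hq hm.ne'
  have hQ : ‖q ^ d‖ < 1 := hlt (by omega)
  have hw : ‖-q ^ r‖ < 1 := by rw [norm_neg]; exact hlt hr1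
  have hv : ‖-q ^ (d - r)‖ < 1 := by rw [norm_neg]; exact hlt (by omega)
  have hpos : ∀ k : ℕ, (-1) ^ (k : ℤ) * q ^ (3 * d * k * (k + 1) / 2 : ℤ) /
      (1 + q ^ ((r : ℤ) + d * k)) =
      (-1) ^ k * (q ^ d) ^ ((k + 1).choose 2 + k * (k + 1)) / (1 - -q ^ r * (q ^ d) ^ k) :=
    fun k => by
      rw [mul_mul_succ_ediv_two, zpow_add₀ hq0, zpow_mul, zpow_mul]
      simp only [zpow_natCast, neg_mul, sub_neg_eq_add]
  have hneg : ∀ k : ℕ, (-1) ^ (-((k : ℤ) + 1)) *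
      q ^ (3 * d * (-((k : ℤ) + 1)) * (-((k : ℤ) + 1) + 1) / 2 : ℤ) /
      (1 + q ^ ((r : ℤ) + d * (-((k : ℤ) + 1)))) =
      -q ^ (d - r) * ((-1) ^ k * (q ^ d) ^ ((k + 1).choose 2 + k * (k + 1)) /
        (1 - -q ^ (d - r) * (q ^ d) ^ k) * (q ^ d) ^ k) :=
    fun k => by
      have e1 : 3 * d * (-((k : ℤ) + 1)) * (-((k : ℤ) + 1) + 1) = 3 * d * k * (k + 1) := by ring
      have e2 : q ^ ((r : ℤ) + d * (-((k : ℤ) + 1))) = (q ^ (d - r) * (q ^ d) ^ k)⁻¹ := by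
        rw [← pow_mul, ← pow_add, ← zpow_natCast, ← zpow_neg]
        congr 1
        push_cast [hr2.le]
        ring
      have e3 : (-1 : ℂ) ^ (-((k : ℤ) + 1)) = -(-1) ^ k := by
        rw [zpow_neg, ← Nat.cast_succ, zpow_natCast, ← inv_pow, inv_neg_one, pow_succ]
        ring
      have h1 := one_sub_mul_pow_ne_zero hQ hv k
      have h2 : q ^ (d - r) * (q ^ d) ^ k ≠ 0 := by positivity
      rw [e1, e2, e3, mul_mul_succ_ediv_two, zpow_mul, zpow_natCast, zpow_natCast]
      rw [neg_mul, sub_neg_eq_add] at h1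
      rw [neg_mul _ ((q ^ d) ^ k), sub_neg_eq_add, div_eq_mul_inv,
        show 1 + (q ^ (d - r) * (q ^ d) ^ k)⁻¹ =
          (1 + q ^ (d - r) * (q ^ d) ^ k) / (q ^ (d - r) * (q ^ d) ^ k) by field_simp; ring, inv_div]
      ring
  have hs1 := summable_sign_mul_pow_div hQ (-q ^ r)
  have hs2 : Summable fun k : ℕ => -q ^ (d - r) *
      ((-1) ^ k * (q ^ d) ^ ((k + 1).choose 2 + k * (k + 1)) /
        (1 - -q ^ (d - r) * (q ^ d) ^ k) * (q ^ d) ^ k) := by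
    refine Summable.mul_left _
      (.of_norm_bounded (summable_sign_mul_pow_div hQ (-q ^ (d - r))).norm fun k => ?_)
    rw [norm_mul, norm_pow]
    exact mul_le_of_le_one_right (norm_nonneg _) (pow_le_one₀ (norm_nonneg _) hQ.le)
  rw [tsum_of_nat_of_neg_add_one (hs1.congr fun k => (hpos k).symm)
    (hs2.congr fun k => (hneg k).symm), tsum_congr hpos, tsum_congr hneg, ← hs1.tsum_add hs2]
  refine tsum_congr fun k => ?_
  have h1 := one_sub_mul_pow_ne_zero hQ hw k
  have h2 := one_sub_mul_pow_ne_zero hQ hv k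
  have h3 : (q ^ d) ^ (2 * k + 1) = -q ^ r * (q ^ d) ^ k * (-q ^ (d - r) * (q ^ d) ^ k) := by
    rw [pow_succ, two_mul, pow_add]
    nth_rewrite 3 [← Nat.add_sub_cancel' hr2.le]
    rw [pow_add]
    ring
  rw [h3]
  have h4 : ∀ A v x : ℂ, v * (A / (1 - v * x) * x) = A * (v * x) / (1 - v * x) := fun A v x => by
    ring
  rw [h4]
  generalize -q ^ r * (q ^ d) ^ k = x, -q ^ (d - r) * (q ^ d) ^ k = y at *
  field_simp
  ring

/-- The difference condition on the parts of a Schur-type partition. -/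
def SchurGap (d a b : ℕ) : Prop := b + d ≤ a ∧ (d ∣ a → b + d < a)

/-- The residue condition on the parts of a Schur-type partition. -/
def SchurResidue (d r x : ℕ) : Prop := x % d = 0 ∨ x % d = r ∨ x % d = d - r

/-- The Schur-type partitions with all parts at least `m`. -/
def schurSet (d r m : ℕ) : Set (List ℕ) := {l | IsSchurPartition d r l ∧ ∀ x ∈ l, m ≤ x}

lemma schurGap_iff {d a b : ℕ} : SchurGap d a b ↔ (b + d + if d ∣ b then 1 else 0) ≤ a := by
  unfold SchurGap
  constructor
  · rintro ⟨h1, h2⟩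
    split_ifs with h
    · rcases h1.eq_or_lt with h3 | h3
      · exact h2 (h3 ▸ h.add (dvd_refl d))
      · exact h3
    · exact h1
  · intro h1
    refine ⟨by omega, fun h2 => lt_of_le_of_ne (by omega) fun h3 => ?_⟩
    rw [if_pos ((Nat.dvd_add_left (dvd_refl d)).mp (h3 ▸ h2))] at h1
    omega

lemma isSchurPartition_iff_pairwise {d r : ℕ} {l : List ℕ} : IsSchurPartition d r l ↔
    (∀ x ∈ l, 0 < x ∧ SchurResidue d r x) ∧ l.Pairwise (SchurGap d) := by
  have : IsTrans ℕ (SchurGap d) :=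
    ⟨fun a b c ⟨h1, h2⟩ ⟨h3, h4⟩ => ⟨by omega, fun h => by have := h2 h; omega⟩⟩
  exact and_congr_right fun _ => List.isChain_iff_pairwise (R := SchurGap d)

lemma schurSet_eq_of_not_schurResidue {d r m : ℕ} (h : ¬ SchurResidue d r m) :
    schurSet d r m = schurSet d r (m + 1) := by
  ext l
  refine and_congr_right fun hl => forall₂_congr fun x hx => ?_
  refine ⟨fun h1 => lt_of_le_of_ne h1 fun h2 => h (h2 ▸ (hl.1 x hx).2), fun h1 => by omega⟩

lemma schurSet_eq_union {d r m : ℕ} (hm : 0 < m) (h : SchurResidue d r m) :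
    schurSet d r m = schurSet d r (m + 1) ∪
      (fun l => l ++ [m]) '' schurSet d r (m + d + if d ∣ m then 1 else 0) := by
  ext l
  simp only [schurSet, Set.mem_union, Set.mem_image, Set.mem_ofPred_eq,
    isSchurPartition_iff_pairwise]
  constructor
  · rintro ⟨⟨h1, h2⟩, h3⟩
    by_cases hml : m ∈ l
    · right
      rcases List.eq_nil_or_concat l with rfl | ⟨L, b, rfl⟩
      · simp at hml
      · simp only [List.concat_eq_append, List.pairwise_append, List.mem_append,
          List.mem_singleton] at *
        have hb : m = b := by
          rcases hml with hml | hml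
          · have := (h2.2.2 m hml b rfl).1
            have := h3 b (.inr rfl)
            omega
          · exact hml
        subst hb
        exact ⟨L, ⟨⟨fun x hx => h1 x (.inl hx), h2.1⟩,
          fun x hx => schurGap_iff.mp (h2.2.2 x hx m rfl)⟩, rfl⟩
    · exact .inl ⟨⟨h1, h2⟩, fun x hx => lt_of_le_of_ne (h3 x hx) fun h4 => hml (h4 ▸ hx)⟩
  · rintro (⟨h1, h2⟩ | ⟨L, ⟨⟨h1, h2⟩, h3⟩, rfl⟩)
    · exact ⟨h1, fun x hx => (Nat.le_succ m).trans (h2 x hx)⟩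
    · simp only [List.pairwise_append, List.mem_append, List.mem_singleton]
      refine ⟨⟨?_, h2, List.pairwise_singleton _ _, ?_⟩, ?_⟩
      · rintro x (hx | rfl)
        · exact h1 x hx
        · exact ⟨hm, h⟩
      · rintro x hx _ rfl
        exact schurGap_iff.mpr (h3 x hx)
      · rintro x (hx | rfl)
        · have := h3 x hx
          omega
        · exact le_rfl

lemma disjoint_schurSet_image {d r m : ℕ} (A : Set (List ℕ)) :
    Disjoint (schurSet d r (m + 1)) ((fun l => l ++ [m]) '' A) := by
  rw [Set.disjoint_left]
  rintro _ ⟨_, h⟩ ⟨L, _, rfl⟩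
  have := h m (by simp)
  omega

lemma summable_schurSet {d : ℕ} (hd : 0 < d) (r m : ℕ) {q : ℂ} (hq : ‖q‖ < 1) :
    Summable fun l : schurSet d r m => ‖q ^ (l : List ℕ).sum‖ := by
  have hpair : ∀ l : schurSet d r m, (l : List ℕ).Pairwise (· > ·) := fun l =>
    (isSchurPartition_iff_pairwise.mp l.2.1).2.imp fun h => by
      have := h.1
      omega
  have hnodup : ∀ l : schurSet d r m, (l : List ℕ).Nodup := fun l => (hpair l).imp fun h => h.ne'
  have hinj : Function.Injective fun l : schurSet d r m => (l : List ℕ).toFinset :=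
    fun l l' h => Subtype.ext ((List.perm_of_nodup_nodup_toFinset_eq (hnodup l) (hnodup l')
      h).eq_of_pairwise' (hpair l) (hpair l'))
  refine ((summable_finsetProd_of_summable_nonneg (fun n : ℕ => by positivity)
    (summable_geometric_of_lt_one (norm_nonneg q) hq)).comp_injective hinj).congr fun l => ?_
  rw [Function.comp_apply, Finset.prod_pow_eq_pow_sum, List.sum_toFinset _ (hnodup l),
    List.map_id', norm_pow]

/-- The generating function of the Schur-type partitions with all parts at least `m`. -/
noncomputable def schurWeight (d r : ℕ) (q : ℂ) (m : ℕ) : ℂ :=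
  ∑' l : schurSet d r m, q ^ (l : List ℕ).sum

lemma schurWeight_of_not_schurResidue {d r m : ℕ} (q : ℂ) (h : ¬ SchurResidue d r m) :
    schurWeight d r q m = schurWeight d r q (m + 1) := by
  rw [schurWeight, schurSet_eq_of_not_schurResidue h, schurWeight]

lemma schurWeight_of_schurResidue {d r m : ℕ} (hd : 0 < d) (hm : 0 < m) {q : ℂ} (hq : ‖q‖ < 1)
    (h : SchurResidue d r m) : schurWeight d r q m = schurWeight d r q (m + 1) +
      q ^ m * schurWeight d r q (m + d + if d ∣ m then 1 else 0) := by
  have hs := fun n => (summable_schurSet hd r n hq).of_norm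
  have hunion := schurSet_eq_union hm h
  simp only [schurWeight]
  generalize schurSet d r (m + d + if d ∣ m then 1 else 0) = A at *
  have hinj : Set.InjOn (fun l : List ℕ => l ++ [m]) A := fun a _ b _ hab => by simpa using hab
  have hsub : (fun l => l ++ [m]) '' A ⊆ schurSet d r m := by
    rw [hunion]
    exact Set.subset_union_right
  have hsum : ∀ l : List ℕ, q ^ (l ++ [m]).sum = q ^ m * q ^ l.sum := fun l => by
    rw [List.sum_append, List.sum_singleton, pow_add, mul_comm]
  generalize hf : (fun l : List ℕ => q ^ l.sum) = f
  have hfl : ∀ l : List ℕ, q ^ l.sum = f l := fun l => congrFun hf l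
  simp only [hfl] at hs hsum ⊢
  have htsum := Summable.tsum_union_disjoint (f := f) (disjoint_schurSet_image A) (hs (m + 1))
    ((hs m).comp_injective (Set.inclusion_injective hsub))
  rw [tsum_image f hinj] at htsum
  rw [hunion, htsum]
  simp only [hsum, tsum_mul_left]

lemma tendsto_schurWeight {d : ℕ} (hd : 0 < d) (r : ℕ) {q : ℂ} (hq : ‖q‖ < 1) :
    Tendsto (schurWeight d r q) atTop (𝓝 1) := by
  have h1 := (summable_subtype_iff_indicator (f := fun l : List ℕ => ‖q ^ l.sum‖)).mp
    (summable_schurSet hd r 0 hq)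
  have h2 : Tendsto
      (fun m => ∑' l, (schurSet d r m).indicator (fun l : List ℕ => q ^ l.sum) l) atTop
      (𝓝 (∑' l : List ℕ, if l = [] then 1 else 0)) := by
    refine tendsto_tsum_of_dominated_convergence h1 (fun l => ?_)
      (Eventually.of_forall fun m l => ?_)
    · rcases l with _ | ⟨a, l⟩
      · refine tendsto_const_nhds.congr fun m => ?_
        rw [Set.indicator_of_mem]
        · simp
        · exact ⟨⟨by simp, List.isChain_nil⟩, by simp⟩
      · rw [if_neg (List.cons_ne_nil _ _)]
        refine tendsto_const_nhds.congr' ((eventually_gt_atTop a).mono fun m hm => ?_)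
        exact (Set.indicator_of_notMem
          (fun h => absurd (h.2 a List.mem_cons_self) hm.not_ge) _).symm
    · rw [norm_indicator_eq_indicator_norm]
      have hsub : schurSet d r m ⊆ schurSet d r 0 := fun l h => ⟨h.1, fun _ _ => Nat.zero_le _⟩
      exact Set.indicator_le_indicator_of_subset hsub (fun l => norm_nonneg _) l
  rw [tsum_ite_eq] at h2
  exact h2.congr fun m => (tsum_subtype _ _).symm

lemma schurCGen_eq_schurWeight {d : ℕ} (hd : 0 < d) (r : ℕ) {q : ℂ} (hq : ‖q‖ < 1) :
    schurCGen d r q = schurWeight d r q (d + 1) := by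
  have h := (summable_schurSet hd r (d + 1) hq).of_norm.hasSum.tsum_fiberwise
    fun l => (l : List ℕ).sum
  rw [schurWeight, ← h.tsum_eq, schurCGen]
  refine tsum_congr fun n => ?_
  have h1 : ∀ l : (fun l : schurSet d r (d + 1) => (l : List ℕ).sum) ⁻¹' {n},
      q ^ ((l : schurSet d r (d + 1)) : List ℕ).sum = q ^ n := fun l => congrArg (q ^ ·) l.2
  rw [tsum_congr h1, tsum_const, nsmul_eq_mul, Nat.card_coe_set_eq,
    ← Set.ncard_image_of_injective _ Subtype.val_injective, schurC]
  congr 3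
  ext l
  simp [schurSet, and_comm, and_left_comm]

lemma schurWeight_skip {d r K i j : ℕ} (q : ℂ) (hi : 0 < i) (hij : i ≤ j) (hj : j ≤ d)
    (h : ∀ t, i ≤ t → t < j → t ≠ r ∧ t ≠ d - r) :
    schurWeight d r q (d * K + i) = schurWeight d r q (d * K + j) := by
  induction j, hij using Nat.le_induction with
  | base => rfl
  | succ j hij ih =>
    rw [ih (by omega) fun t h1 h2 => h t h1 (by omega), schurWeight_of_not_schurResidue, add_assoc]
    rw [SchurResidue, Nat.mul_add_mod, Nat.mod_eq_of_lt (by omega)]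
    have := h j hij (by omega)
    omega

lemma schurWeight_rec {d r : ℕ} (hr1 : 1 ≤ r) (hr2 : 2 * r < d) {q : ℂ} (hq : ‖q‖ < 1) (K : ℕ) :
    schurWeight d r q (d * K + 1) =
      (1 + (q ^ r + q ^ (d - r)) * (q ^ d) ^ K) * schurWeight d r q (d * (K + 1) + 1) +
        (q ^ d) ^ (K + 1) * (1 - (q ^ d) ^ (K + 1)) * schurWeight d r q (d * (K + 2) + 1) := by
  have hd : 0 < d := by omega
  have hmid : ∀ {s}, 0 < s → s < d → (s = r ∨ s = d - r) → ∀ K, schurWeight d r q (d * K + s) =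
      schurWeight d r q (d * K + (s + 1)) +
        q ^ s * (q ^ d) ^ K * schurWeight d r q (d * (K + 1) + s) := fun {s} h0 h1 h2 K => by
    rw [schurWeight_of_schurResidue hd (by omega) hq, if_neg, pow_add, pow_mul, add_assoc, add_zero,
      show d * K + s + d = d * (K + 1) + s by ring, mul_comm (q ^ s)]
    · rw [Nat.dvd_add_right (dvd_mul_right d K)]
      exact Nat.not_dvd_of_pos_of_lt h0 h1
    · rw [SchurResidue, Nat.mul_add_mod, Nat.mod_eq_of_lt h1]
      exact .inr h2
  have hlast : ∀ K, schurWeight d r q (d * K + d) = schurWeight d r q (d * (K + 1) + 1) +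
      (q ^ d) ^ (K + 1) * schurWeight d r q (d * (K + 2) + 1) := fun K => by
    rw [show d * K + d = d * (K + 1) by ring, schurWeight_of_schurResidue hd (by positivity) hq,
      if_pos (dvd_mul_right d _), pow_mul, show d * (K + 1) + d = d * (K + 2) by ring]
    rw [SchurResidue, Nat.mul_mod_right]
    exact .inl rfl
  have hlow : ∀ K, schurWeight d r q (d * K + 1) = schurWeight d r q (d * K + r) := fun K =>
    schurWeight_skip q one_pos hr1 (by omega) fun t h1 h2 => by omega
  have e1 : ∀ K, schurWeight d r q (d * K + 1) = schurWeight d r q (d * K + (d - r)) +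
      q ^ r * (q ^ d) ^ K * schurWeight d r q (d * (K + 1) + 1) := fun K => by
    rw [hlow K, hmid hr1 (by omega) (.inl rfl), hlow (K + 1),
      schurWeight_skip (i := r + 1) (j := d - r) q (by omega) (by omega) (by omega)
        fun t h1 h2 => by omega]
  have e2 : schurWeight d r q (d * K + (d - r)) = schurWeight d r q (d * K + d) +
      q ^ (d - r) * (q ^ d) ^ K * schurWeight d r q (d * (K + 1) + (d - r)) := by
    rw [hmid (by omega) (by omega) (.inr rfl),
      schurWeight_skip (i := d - r + 1) (j := d) q (by omega) (by omega) le_rfl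
        fun t h1 h2 => by omega]
  have e3 : q ^ r * q ^ (d - r) = q ^ d := by rw [← pow_add, Nat.add_sub_cancel' (by omega)]
  rw [e1 K, e2, hlast K]
  have e4 := e1 (K + 1)
  rw [add_assoc K 1 1] at e4
  linear_combination -(q ^ (d - r) * (q ^ d) ^ K) * e4 -
    ((q ^ d) ^ K * (q ^ d) ^ (K + 1) * schurWeight d r q (d * (K + 2) + 1)) * e3

/-- `𝒞_{d,r}(q) = ((-q^r; q^d)_∞ (-q^{d-r}; q^d)_∞ / (q^d; q^d)_∞) ·
Σ_{n∈ℤ} (-1)^n q^{3dn(n+1)/2} / (1 + q^{r+dn})`. -/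
theorem schurCGen_bilateral (d r : ℕ) (hd : 3 ≤ d) (hr1 : 1 ≤ r) (hr2 : 2 * r < d)
    (q : ℂ) (hq : ‖q‖ < 1) (hq0 : q ≠ 0) :
    schurCGen d r q =
      qPochInf (-q ^ r) (q ^ d) * qPochInf (-q ^ (d - r)) (q ^ d) / qPochInf (q ^ d) (q ^ d) *
        ∑' n : ℤ, (-1) ^ n * q ^ (3 * d * n * (n + 1) / 2) / (1 + q ^ ((r : ℤ) + d * n)) := by
  have hd0 : 0 < d := by omega
  have hlt : ∀ {m : ℕ}, 0 < m → ‖q ^ m‖ < 1 := fun hm => by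
    rw [norm_pow]; exact pow_lt_one₀ (norm_nonneg q) hq hm.ne'
  have hQ : ‖q ^ d‖ < 1 := hlt hd0
  have hw : ‖-q ^ r‖ < 1 := by rw [norm_neg]; exact hlt hr1
  have hv : ‖-q ^ (d - r)‖ < 1 := by rw [norm_neg]; exact hlt (by omega)
  have hwv : -q ^ r * -q ^ (d - r) = q ^ d := by
    rw [neg_mul_neg, ← pow_add, Nat.add_sub_cancel' (by omega)]
  have hrec : ∀ k, schurWeight d r q (d * (k + 1) + 1) =
      (1 - (-q ^ r + -q ^ (d - r)) * (q ^ d) ^ (k + 1)) *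
        schurWeight d r q (d * (k + 1 + 1) + 1) +
      (q ^ d) ^ (k + 2) * (1 - (q ^ d) ^ (k + 2)) * schurWeight d r q (d * (k + 2 + 1) + 1) :=
    fun k => by
      rw [schurWeight_rec hr1 hr2 hq (k + 1)]
      ring
  have hlim : Tendsto (fun k => schurWeight d r q (d * (k + 1) + 1)) atTop (𝓝 1) :=
    (tendsto_schurWeight hd0 r hq).comp
      (tendsto_atTop_mono (fun k => by dsimp only [id]; nlinarith) tendsto_id)
  have h0 := eq_schurSol hQ hw hv hwv hrec hlim 0
  rw [zero_add, mul_one] at h0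
  rw [schurCGen_eq_schurWeight hd0 r hq, h0, schurSol_zero hQ hw hv,
    tsum_mockTheta_eq hQ hwv (one_sub_mul_pow_ne_zero hQ hw) (one_sub_mul_pow_ne_zero hQ hv),
    tsum_int_eq_tsum_nat hr1 (by omega) hq hq0]
  ring
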